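/- arXiv:2312.03784 — 2 statements merged into one kernel-verified Lean document; each statement's English description precedes it below -/
import Mathlib

section
/- For every probability distribution q on 𝒳 and every Δ ≥ 0, the rate-distortion function admits the parametric expression R(Δ|q) = sup_{ν≥0} [ −νΔ + min_{p_Y ∈ 𝒫(𝒴)} ( −∑_x q(x) log ∑_y p_Y(y) e^{−ν d(x,y)} ) ]. -/
open scoped BigOperators

/-- `p` is a probability distribution on the finite set `X`. -/
def IsDist {X : Type*} [Fintype X] (p : X → ℝ) : Prop :=
  (∀ x, 0 ≤ p x) ∧ ∑ x, p x = 1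

/-- `V` is a conditional probability distribution on `Y` given `X`. -/
def IsCondDist {X Y : Type*} [Fintype Y] (V : X → Y → ℝ) : Prop :=
  ∀ x, IsDist (V x)

/-- Mutual information `I(q,V)` with the convention `0 log 0 = 0`. -/
noncomputable def mutInfo {X Y : Type*} [Fintype X] [Fintype Y]
    (q : X → ℝ) (V : X → Y → ℝ) : ℝ :=
  ∑ x, ∑ y, if q x * V x y = 0 then 0
    else q x * V x y * Real.log (V x y / ∑ x', q x' * V x' y)

/-- The rate-distortion function `R(Δ|q)`. -/
noncomputable def rateDist {X Y : Type*} [Fintype X] [Fintype Y]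
    (d : X → Y → ℝ) (Δ : ℝ) (q : X → ℝ) : ℝ :=
  sInf { r | ∃ V : X → Y → ℝ, IsCondDist V ∧
    (∑ x, ∑ y, q x * V x y * d x y) ≤ Δ ∧ r = mutInfo q V }

/-- Relative entropy `D(q‖P)` (real-valued; convention `0 log 0 = 0`). -/
noncomputable def relEnt {X : Type*} [Fintype X] (q P : X → ℝ) : ℝ :=
  ∑ x, if q x = 0 then 0 else q x * Real.log (q x / P x)

/-- Absolute continuity: `q(x) = 0` whenever `P(x) = 0` (finiteness of `D(q‖P)`). -/
def AbsCont {X : Type*} (q P : X → ℝ) : Prop := ∀ x, P x = 0 → q x = 0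

section LogInequalities

/-- The tangent-line bound for `s ↦ s log (s / u)` at slope `log c`. -/
lemma mul_log_add_sub_le_mul_log_div {s u c : ℝ} (hs : 0 ≤ s) (hu : 0 ≤ u) (hc : 0 < c)
    (hsu : u = 0 → s = 0) : s * Real.log c + s - c * u ≤ s * Real.log (s / u) := by
  rcases hs.eq_or_lt with rfl | hs
  · simpa using mul_nonneg hc.le hu
  have hu : 0 < u := hu.lt_of_ne' fun h => hs.ne' (hsu h)
  have h1 : 1 - (s / (c * u))⁻¹ ≤ Real.log (s / (c * u)) :=
    Real.one_sub_inv_le_log_of_pos (by positivity)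
  have h2 : Real.log (s / (c * u)) = Real.log (s / u) - Real.log c := by
    rw [mul_comm, ← div_div, Real.log_div (by positivity) hc.ne']
  rw [h2] at h1
  have h3 := mul_le_mul_of_nonneg_left h1 hs.le
  have h4 : s * (1 - (s / (c * u))⁻¹) = s - c * u := by field_simp
  linarith

/-- The two-term log-sum inequality: `(s, u) ↦ s log (s / u)` is jointly convex. -/
lemma mul_log_div_convex {a b s t u v : ℝ} (ha : 0 ≤ a) (hb : 0 ≤ b) (hs : 0 ≤ s) (ht : 0 ≤ t)
    (hu : 0 ≤ u) (hv : 0 ≤ v) (hsu : u = 0 → s = 0) (htv : v = 0 → t = 0) :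
    (a * s + b * t) * Real.log ((a * s + b * t) / (a * u + b * v)) ≤
      a * (s * Real.log (s / u)) + b * (t * Real.log (t / v)) := by
  have has : 0 ≤ a * s := mul_nonneg ha hs
  have hbt : 0 ≤ b * t := mul_nonneg hb ht
  have hau : 0 ≤ a * u := mul_nonneg ha hu
  have hbv : 0 ≤ b * v := mul_nonneg hb hv
  rcases (add_nonneg has hbt).eq_or_lt with h0 | hpos
  · have h1 : a * s = 0 := by linarith
    have h2 : b * t = 0 := by linarith
    simp [← mul_assoc, h1, h2]
  have hden : 0 < a * u + b * v := by
    refine (add_nonneg hau hbv).lt_of_ne' fun h => ?_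
    have h1 : a * u = 0 := by linarith
    have h2 : b * v = 0 := by linarith
    have h3 : a * s = 0 := by
      rcases mul_eq_zero.1 h1 with h | h
      · simp [h]
      · simp [hsu h]
    have h4 : b * t = 0 := by
      rcases mul_eq_zero.1 h2 with h | h
      · simp [h]
      · simp [htv h]
    linarith
  set c := (a * s + b * t) / (a * u + b * v) with hc
  have hcpos : 0 < c := div_pos hpos hden
  have hcm : c * (a * u + b * v) = a * s + b * t := div_mul_cancel₀ _ hden.ne'
  have h1 := mul_le_mul_of_nonneg_left (mul_log_add_sub_le_mul_log_div hs hu hcpos hsu) ha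
  have h2 := mul_le_mul_of_nonneg_left (mul_log_add_sub_le_mul_log_div ht hv hcpos htv) hb
  linarith

end LogInequalities

section CondDist

variable {X Y : Type*} [Fintype Y]

lemma IsCondDist.convexComb {V W : X → Y → ℝ} (hV : IsCondDist V) (hW : IsCondDist W) {a b : ℝ}
    (ha : 0 ≤ a) (hb : 0 ≤ b) (hab : a + b = 1) : IsCondDist fun x y => a * V x y + b * W x y := by
  refine fun x => ⟨fun y => add_nonneg (mul_nonneg ha ((hV x).1 y)) (mul_nonneg hb ((hW x).1 y)),
    ?_⟩
  rw [Finset.sum_add_distrib, ← Finset.mul_sum, ← Finset.mul_sum, (hV x).2, (hW x).2]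
  linarith

lemma isCompact_setOf_isCondDist : IsCompact {V : X → Y → ℝ | IsCondDist V} := by
  have h : {V : X → Y → ℝ | IsCondDist V} = Set.univ.pi fun _ => stdSimplex ℝ Y := by
    ext V
    simp [IsCondDist, IsDist, stdSimplex]
  rw [h]
  exact isCompact_univ_pi fun _ => isCompact_stdSimplex ℝ Y

end CondDist

section Channel

variable {X Y : Type*} [Fintype X]

/-- The output distribution of the channel `V` with input distribution `q`. -/
def outDist (q : X → ℝ) (V : X → Y → ℝ) (y : Y) : ℝ := ∑ x, q x * V x y

lemma outDist_convexComb (q : X → ℝ) (V W : X → Y → ℝ) (a b : ℝ) (y : Y) :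
    outDist q (fun x y => a * V x y + b * W x y) y = a * outDist q V y + b * outDist q W y := by
  simp only [outDist, Finset.mul_sum, ← Finset.sum_add_distrib]
  exact Finset.sum_congr rfl fun x _ => by ring

variable [Fintype Y]

/-- The expected distortion of the channel `V` with input distribution `q`. -/
def expDist (d : X → Y → ℝ) (q : X → ℝ) (V : X → Y → ℝ) : ℝ := ∑ x, ∑ y, q x * V x y * d x y

lemma mutInfo_eq (q : X → ℝ) (V : X → Y → ℝ) :
    mutInfo q V = ∑ x, q x * ∑ y, V x y * Real.log (V x y / outDist q V y) := by
  unfold mutInfo outDist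
  refine Finset.sum_congr rfl fun x _ => ?_
  rw [Finset.mul_sum]
  refine Finset.sum_congr rfl fun y _ => ?_
  split_ifs with h
  · rw [← mul_assoc, h, zero_mul]
  · rw [mul_assoc]

lemma expDist_eq (d : X → Y → ℝ) (q : X → ℝ) (V : X → Y → ℝ) :
    expDist d q V = ∑ x, q x * ∑ y, V x y * d x y := by
  simp only [expDist, Finset.mul_sum, mul_assoc]

variable {q : X → ℝ} {V W : X → Y → ℝ}

lemma outDist_nonneg (hq : IsDist q) (hV : IsCondDist V) (y : Y) : 0 ≤ outDist q V y :=
  Finset.sum_nonneg fun x _ => mul_nonneg (hq.1 x) ((hV x).1 y)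

lemma isDist_outDist (hq : IsDist q) (hV : IsCondDist V) : IsDist (outDist q V) := by
  refine ⟨outDist_nonneg hq hV, ?_⟩
  simp only [outDist]
  rw [Finset.sum_comm]
  simp only [← Finset.mul_sum, (hV _).2, mul_one, hq.2]

lemma mul_eq_zero_of_outDist_eq_zero (hq : IsDist q) (hV : IsCondDist V) {y : Y}
    (h : outDist q V y = 0) (x : X) : q x * V x y = 0 :=
  (Finset.sum_eq_zero_iff_of_nonneg
    (fun x _ => mul_nonneg (hq.1 x) ((hV x).1 y))).1 h x (Finset.mem_univ x)

lemma eq_zero_of_outDist_eq_zero (hq : IsDist q) (hV : IsCondDist V) {x : X} (hx : q x ≠ 0)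
    {y : Y} (h : outDist q V y = 0) : V x y = 0 :=
  (mul_eq_zero.1 (mul_eq_zero_of_outDist_eq_zero hq hV h x)).resolve_left hx

lemma mutInfo_nonneg (hq : IsDist q) (hV : IsCondDist V) : 0 ≤ mutInfo q V := by
  rw [mutInfo_eq]
  refine Finset.sum_nonneg fun x _ => ?_
  rcases eq_or_ne (q x) 0 with hx | hx
  · simp [hx]
  refine mul_nonneg (hq.1 x) ?_
  calc (0 : ℝ) = ∑ y, (V x y * Real.log 1 + V x y - 1 * outDist q V y) := by
        simp [Finset.sum_sub_distrib, (hV x).2, (isDist_outDist hq hV).2]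
    _ ≤ _ := Finset.sum_le_sum fun y _ => mul_log_add_sub_le_mul_log_div ((hV x).1 y)
        (outDist_nonneg hq hV y) one_pos (eq_zero_of_outDist_eq_zero hq hV hx)

lemma expDist_convexComb (d : X → Y → ℝ) (a b : ℝ) :
    expDist d q (fun x y => a * V x y + b * W x y) = a * expDist d q V + b * expDist d q W := by
  simp only [expDist, Finset.mul_sum, ← Finset.sum_add_distrib]
  exact Finset.sum_congr rfl fun x _ => Finset.sum_congr rfl fun y _ => by ring

lemma mutInfo_convexComb_le (hq : IsDist q) (hV : IsCondDist V) (hW : IsCondDist W) {a b : ℝ}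
    (ha : 0 ≤ a) (hb : 0 ≤ b) :
    mutInfo q (fun x y => a * V x y + b * W x y) ≤ a * mutInfo q V + b * mutInfo q W := by
  simp only [mutInfo_eq, outDist_convexComb]
  rw [Finset.mul_sum, Finset.mul_sum, ← Finset.sum_add_distrib]
  refine Finset.sum_le_sum fun x _ => ?_
  rcases eq_or_ne (q x) 0 with hx | hx
  · simp [hx]
  rw [mul_left_comm a, mul_left_comm b, ← mul_add, Finset.mul_sum _ _ a,
    Finset.mul_sum _ _ b, ← Finset.sum_add_distrib]
  refine mul_le_mul_of_nonneg_left (Finset.sum_le_sum fun y _ => ?_) (hq.1 x)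
  exact mul_log_div_convex ha hb ((hV x).1 y) ((hW x).1 y) (outDist_nonneg hq hV y)
    (outDist_nonneg hq hW y) (eq_zero_of_outDist_eq_zero hq hV hx)
    (eq_zero_of_outDist_eq_zero hq hW hx)

lemma mutInfo_eq_entropy_sub (hq : IsDist q) (hV : IsCondDist V) :
    mutInfo q V = ∑ x, ∑ y, q x * (V x y * Real.log (V x y)) -
      ∑ y, outDist q V y * Real.log (outDist q V y) := by
  have h : ∑ y, outDist q V y * Real.log (outDist q V y) =
      ∑ x, ∑ y, q x * V x y * Real.log (outDist q V y) := by
    rw [Finset.sum_comm]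
    refine Finset.sum_congr rfl fun y _ => ?_
    rw [← Finset.sum_mul]
    rfl
  rw [h, mutInfo_eq, ← Finset.sum_sub_distrib]
  refine Finset.sum_congr rfl fun x _ => ?_
  rw [Finset.mul_sum, ← Finset.sum_sub_distrib]
  refine Finset.sum_congr rfl fun y _ => ?_
  rcases eq_or_ne (q x) 0 with hx | hx
  · simp [hx]
  rcases eq_or_ne (V x y) 0 with hxy | hxy
  · simp [hxy]
  rw [Real.log_div hxy fun h => hxy (eq_zero_of_outDist_eq_zero hq hV hx h)]
  ring

lemma continuousOn_mutInfo (hq : IsDist q) :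
    ContinuousOn (mutInfo q) {V : X → Y → ℝ | IsCondDist V} := by
  have hcont : Continuous fun V : X → Y → ℝ => ∑ x, ∑ y, q x * (V x y * Real.log (V x y)) -
      ∑ y, outDist q V y * Real.log (outDist q V y) := by
    have hout (y : Y) : Continuous fun V : X → Y → ℝ => outDist q V y := by
      unfold outDist
      fun_prop
    refine Continuous.sub ?_ (continuous_finsetSum _ fun y _ =>
      Real.continuous_mul_log.comp (hout y))
    exact continuous_finsetSum _ fun x _ => continuous_finsetSum _ fun y _ =>
      continuous_const.mul (Real.continuous_mul_log.comp (by fun_prop))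
  exact hcont.continuousOn.congr fun V hV => mutInfo_eq_entropy_sub hq hV

lemma continuous_expDist (d : X → Y → ℝ) (q : X → ℝ) : Continuous (expDist d q) := by
  unfold expDist
  fun_prop

/-- A distortion measure with `max_x min_y d x y = 0` admits a channel with zero distortion. -/
lemma exists_isCondDist_expDist_eq_zero [Nonempty Y] {d : X → Y → ℝ} (hd : ∀ x y, 0 ≤ d x y)
    (hd0 : (⨆ x, ⨅ y, d x y) = 0) (q : X → ℝ) :
    ∃ V : X → Y → ℝ, IsCondDist V ∧ expDist d q V = 0 := by
  classical
  have h (x : X) : ∃ y, d x y = 0 := by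
    obtain ⟨y, hy⟩ := exists_eq_ciInf_of_finite (f := d x)
    refine ⟨y, le_antisymm ?_ (hd x y)⟩
    rw [hy, ← hd0]
    exact le_ciSup (f := fun x => ⨅ y, d x y) (Set.finite_range _).bddAbove x
  choose f hf using h
  refine ⟨fun x y => if y = f x then 1 else 0, fun x => ⟨fun y => ?_, by simp⟩, ?_⟩
  · dsimp only
    split_ifs <;> simp
  · simp [expDist, hf]

end Channel

section Functional

variable {X Y : Type*} [Fintype Y]

/-- The normaliser `∑ y, p y * exp (-ν * d x y)` of the tilted channel. -/
noncomputable def tiltSum (d : X → Y → ℝ) (ν : ℝ) (p : Y → ℝ) (x : X) : ℝ :=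
  ∑ y, p y * Real.exp (-ν * d x y)

variable {d : X → Y → ℝ} {ν : ℝ} {q : X → ℝ} {p : Y → ℝ}

lemma tiltSum_pos (hp : IsDist p) (x : X) : 0 < tiltSum d ν p x := by
  have hnn : ∀ y ∈ Finset.univ, 0 ≤ p y * Real.exp (-ν * d x y) :=
    fun y _ => mul_nonneg (hp.1 y) (Real.exp_pos _).le
  refine (Finset.sum_nonneg hnn).lt_of_ne' fun h => ?_
  have h0 (y : Y) : p y = 0 :=
    (mul_eq_zero.1 ((Finset.sum_eq_zero_iff_of_nonneg hnn).1 h y (Finset.mem_univ y))).resolve_right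
      (Real.exp_pos _).ne'
  simpa [h0] using hp.2

variable [Fintype X]

/-- The functional at the output distribution of a channel is at most its Lagrangian. -/
lemma neg_sum_log_tiltSum_outDist_le {V : X → Y → ℝ} (hq : IsDist q) (hV : IsCondDist V) :
    -∑ x, q x * Real.log (tiltSum d ν (outDist q V) x) ≤ mutInfo q V + ν * expDist d q V := by
  rw [mutInfo_eq, expDist_eq, Finset.mul_sum, ← Finset.sum_neg_distrib, ← Finset.sum_add_distrib]
  refine Finset.sum_le_sum fun x _ => ?_
  rcases eq_or_ne (q x) 0 with hx | hx
  · simp [hx]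
  set Z := tiltSum d ν (outDist q V) x with hZ
  have hZpos : 0 < Z := tiltSum_pos (isDist_outDist hq hV) x
  have hlog (y : Y) : Real.log (Real.exp (-ν * d x y) / Z) = -ν * d x y - Real.log Z := by
    rw [Real.log_div (Real.exp_pos _).ne' hZpos.ne', Real.log_exp]
  have hZ1 : ∑ y, Real.exp (-ν * d x y) / Z * outDist q V y = 1 := by
    rw [← div_self hZpos.ne']
    nth_rw 2 [hZ]
    rw [tiltSum, Finset.sum_div]
    exact Finset.sum_congr rfl fun y _ => by ring
  have hle := Finset.sum_le_sum fun y (_ : y ∈ Finset.univ) =>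
    mul_log_add_sub_le_mul_log_div ((hV x).1 y) (outDist_nonneg hq hV y)
      (div_pos (Real.exp_pos (-ν * d x y)) hZpos) (eq_zero_of_outDist_eq_zero hq hV hx)
  rw [Finset.sum_sub_distrib, Finset.sum_add_distrib, hZ1, (hV x).2] at hle
  have hsum : ∑ y, V x y * Real.log (Real.exp (-ν * d x y) / Z) =
      -ν * ∑ y, V x y * d x y - Real.log Z := by
    calc _ = ∑ y, (-ν * (V x y * d x y) - V x y * Real.log Z) :=
          Finset.sum_congr rfl fun y _ => by rw [hlog]; ring
      _ = _ := by rw [Finset.sum_sub_distrib, ← Finset.mul_sum, ← Finset.sum_mul, (hV x).2, one_mul]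
  rw [hsum] at hle
  have := mul_le_mul_of_nonneg_left hle (hq.1 x)
  linarith

/-- The Lagrangian of the tilted channel of `p` is at most the functional at `p`. -/
lemma exists_lagrangian_le_neg_sum_log_tiltSum (hq : IsDist q) (hp : IsDist p) :
    ∃ V : X → Y → ℝ, IsCondDist V ∧
      mutInfo q V + ν * expDist d q V ≤ -∑ x, q x * Real.log (tiltSum d ν p x) := by
  have hZpos (x : X) : 0 < tiltSum d ν p x := tiltSum_pos hp x
  set V : X → Y → ℝ := fun x y => p y * Real.exp (-ν * d x y) / tiltSum d ν p x with hVdef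
  have hV : IsCondDist V := fun x =>
    ⟨fun y => div_nonneg (mul_nonneg (hp.1 y) (Real.exp_pos _).le) (hZpos x).le, by
      simp only [hVdef]
      rw [← Finset.sum_div]
      exact div_self (hZpos x).ne'⟩
  refine ⟨V, hV, ?_⟩
  have hterm (x : X) (y : Y) : q x * (V x y * Real.log (V x y / outDist q V y)) =
      q x * (V x y * (-ν * d x y - Real.log (tiltSum d ν p x))) -
        q x * V x y * Real.log (outDist q V y / p y) := by
    rcases eq_or_ne (q x) 0 with hx | hx
    · simp [hx]
    rcases eq_or_ne (V x y) 0 with hxy | hxy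
    · simp [hxy]
    have hpy : p y ≠ 0 := fun h => hxy (by simp [hVdef, h])
    have ho : outDist q V y ≠ 0 := fun h => hxy (eq_zero_of_outDist_eq_zero hq hV hx h)
    rw [Real.log_div hxy ho, Real.log_div ho hpy]
    simp only [hVdef]
    rw [Real.log_div (mul_ne_zero hpy (Real.exp_pos _).ne') (hZpos x).ne',
      Real.log_mul hpy (Real.exp_pos _).ne', Real.log_exp]
    ring
  have hdiv : 0 ≤ ∑ x, ∑ y, q x * V x y * Real.log (outDist q V y / p y) := by
    rw [Finset.sum_comm]
    calc (0 : ℝ) = ∑ y, (outDist q V y * Real.log 1 + outDist q V y - 1 * p y) := by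
          simp [Finset.sum_sub_distrib, (isDist_outDist hq hV).2, hp.2]
      _ ≤ ∑ y, outDist q V y * Real.log (outDist q V y / p y) :=
          Finset.sum_le_sum fun y _ => mul_log_add_sub_le_mul_log_div (outDist_nonneg hq hV y)
            (hp.1 y) one_pos fun h => by simp [outDist, hVdef, h]
      _ = _ := Finset.sum_congr rfl fun y _ => by rw [← Finset.sum_mul]; rfl
  have hI : mutInfo q V = -ν * expDist d q V - ∑ x, q x * Real.log (tiltSum d ν p x) -
      ∑ x, ∑ y, q x * V x y * Real.log (outDist q V y / p y) := by
    rw [mutInfo_eq, expDist_eq, Finset.mul_sum, ← Finset.sum_sub_distrib, ← Finset.sum_sub_distrib]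
    refine Finset.sum_congr rfl fun x _ => ?_
    simp only [Finset.mul_sum] at hterm ⊢
    rw [Finset.sum_congr rfl fun y _ => hterm x y, Finset.sum_sub_distrib]
    congr 1
    calc _ = ∑ y, (-ν * (q x * (V x y * d x y)) -
          V x y * (q x * Real.log (tiltSum d ν p x))) :=
          Finset.sum_congr rfl fun y _ => by ring
      _ = _ := by rw [Finset.sum_sub_distrib, ← Finset.sum_mul, (hV x).2, one_mul]
  linarith

end Functional

section RateDistortion

variable {X Y : Type*} [Fintype X] [Fintype Y] {d : X → Y → ℝ} {q : X → ℝ}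

lemma rateDist_le (hq : IsDist q) {V : X → Y → ℝ} (hV : IsCondDist V) {Δ : ℝ}
    (h : expDist d q V ≤ Δ) : rateDist d Δ q ≤ mutInfo q V :=
  csInf_le ⟨0, by rintro _ ⟨V, hV, -, rfl⟩; exact mutInfo_nonneg hq hV⟩ ⟨V, hV, h, rfl⟩

lemma le_rateDist {Δ r : ℝ} (hfeas : ∃ V : X → Y → ℝ, IsCondDist V ∧ expDist d q V ≤ Δ)
    (h : ∀ V : X → Y → ℝ, IsCondDist V → expDist d q V ≤ Δ → r ≤ mutInfo q V) :
    r ≤ rateDist d Δ q := by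
  obtain ⟨V, hV, hVΔ⟩ := hfeas
  refine le_csInf ⟨_, V, hV, hVΔ, rfl⟩ ?_
  rintro _ ⟨W, hW, hWΔ, rfl⟩
  exact h W hW hWΔ

lemma exists_mutInfo_lt {Δ r : ℝ} (hfeas : ∃ V : X → Y → ℝ, IsCondDist V ∧ expDist d q V ≤ Δ)
    (h : rateDist d Δ q < r) :
    ∃ V : X → Y → ℝ, IsCondDist V ∧ expDist d q V ≤ Δ ∧ mutInfo q V < r := by
  by_contra! hcon
  exact h.not_ge (le_rateDist hfeas hcon)

lemma convexOn_rateDist (hq : IsDist q)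
    (hfeas : ∃ V : X → Y → ℝ, IsCondDist V ∧ expDist d q V = 0) :
    ConvexOn ℝ (Set.Ici 0) fun Δ => rateDist d Δ q := by
  refine ⟨convex_Ici 0, fun s hs t ht a b ha hb hab => ?_⟩
  obtain ⟨V₀, hV₀, h₀⟩ := hfeas
  refine le_of_forall_pos_lt_add fun ε hε => ?_
  obtain ⟨V, hV, hVs, hVI⟩ := exists_mutInfo_lt (d := d) (q := q) (Δ := s)
    ⟨V₀, hV₀, h₀.trans_le hs⟩ (lt_add_of_pos_right _ (half_pos hε))
  obtain ⟨W, hW, hWt, hWI⟩ := exists_mutInfo_lt (d := d) (q := q) (Δ := t)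
    ⟨V₀, hV₀, h₀.trans_le ht⟩ (lt_add_of_pos_right _ (half_pos hε))
  have h1 := rateDist_le (d := d) (Δ := a * s + b * t) hq (hV.convexComb hW ha hb hab) (by
    rw [expDist_convexComb]
    exact add_le_add (mul_le_mul_of_nonneg_left hVs ha) (mul_le_mul_of_nonneg_left hWt hb))
  have h2 := mutInfo_convexComb_le hq hV hW ha hb
  have h3 := mul_le_mul_of_nonneg_left hVI.le ha
  have h4 := mul_le_mul_of_nonneg_left hWI.le hb
  have h5 : a * (ε / 2) + b * (ε / 2) = ε / 2 := by rw [← add_mul, hab, one_mul]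
  simp only [smul_eq_mul]
  linarith

/-- At a positive distortion level the rate-distortion function has a Lagrange multiplier. -/
lemma exists_multiplier (hq : IsDist q) (hd : ∀ x y, 0 ≤ d x y)
    (hfeas : ∃ V : X → Y → ℝ, IsCondDist V ∧ expDist d q V = 0) {Δ : ℝ} (hΔ : 0 < Δ) :
    ∃ ν : ℝ, 0 ≤ ν ∧ ∀ V : X → Y → ℝ, IsCondDist V →
      rateDist d Δ q + ν * Δ ≤ mutInfo q V + ν * expDist d q V := by
  have hconv := convexOn_rateDist hq hfeas
  set R : ℝ → ℝ := fun Δ => rateDist d Δ q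
  have hint : Δ ∈ interior (Set.Ici (0 : ℝ)) := by simpa using hΔ
  set c := derivWithin R (Set.Ioi Δ) Δ
  have hsub : ∀ t, 0 ≤ t → R Δ + c * (t - Δ) ≤ R t := by
    intro t ht
    rcases lt_trichotomy t Δ with h | rfl | h
    · have h1 := (hconv.slope_le_leftDeriv_of_mem_interior ht hint h).trans
        (hconv.leftDeriv_le_rightDeriv_of_mem_interior hint)
      rw [slope_def_field, div_le_iff₀ (sub_pos.2 h)] at h1
      linarith
    · simp
    · have h1 := hconv.rightDeriv_le_slope_of_mem_interior hint ht h
      rw [slope_def_field, le_div_iff₀ (sub_pos.2 h)] at h1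
      linarith
  obtain ⟨V₀, hV₀, h₀⟩ := hfeas
  have hmono : R (Δ + 1) ≤ R Δ := le_rateDist ⟨V₀, hV₀, h₀.trans_le hΔ.le⟩ fun V hV hVΔ =>
    rateDist_le hq hV (by linarith)
  refine ⟨-c, by linarith [hsub (Δ + 1) (by linarith)], fun V hV => ?_⟩
  have hnn : 0 ≤ expDist d q V := Finset.sum_nonneg fun x _ => Finset.sum_nonneg fun y _ =>
    mul_nonneg (mul_nonneg (hq.1 x) ((hV x).1 y)) (hd x y)
  have h1 := hsub _ hnn
  have h2 : R (expDist d q V) ≤ mutInfo q V := rateDist_le hq hV le_rfl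
  change R Δ + _ ≤ _
  linarith

/-- The rate-distortion function is lower semicontinuous from the right. -/
lemma rateDist_le_of_forall_pos (hq : IsDist q) {Δ s : ℝ}
    (hfeas : ∃ V : X → Y → ℝ, IsCondDist V ∧ expDist d q V ≤ Δ)
    (h : ∀ ε > 0, rateDist d (Δ + ε) q ≤ s) : rateDist d Δ q ≤ s := by
  obtain ⟨V₀, hV₀, h₀⟩ := hfeas
  have hcont : ContinuousOn (fun V => max (expDist d q V - Δ) (mutInfo q V - s))
      {V : X → Y → ℝ | IsCondDist V} :=
    ContinuousOn.sup ((continuous_expDist d q).continuousOn.sub continuousOn_const)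
      ((continuousOn_mutInfo hq).sub continuousOn_const)
  obtain ⟨V, hV, hmin⟩ := isCompact_setOf_isCondDist.exists_isMinOn ⟨V₀, hV₀⟩ hcont
  have hle : max (expDist d q V - Δ) (mutInfo q V - s) ≤ 0 := by
    by_contra! hpos
    set ε := max (expDist d q V - Δ) (mutInfo q V - s) / 2 with hε
    have hεpos : 0 < ε := half_pos hpos
    obtain ⟨W, hW, hWΔ, hWI⟩ := exists_mutInfo_lt (d := d) (q := q) (Δ := Δ + ε) (r := s + ε)
      ⟨V₀, hV₀, by linarith⟩ (by linarith [h ε hεpos])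
    have h1 : max (expDist d q V - Δ) (mutInfo q V - s) ≤
        max (expDist d q W - Δ) (mutInfo q W - s) := hmin hW
    have h2 : max (expDist d q W - Δ) (mutInfo q W - s) ≤ ε :=
      max_le (by linarith) (by linarith)
    linarith
  have h1 := (le_max_left _ _).trans hle
  have h2 := (le_max_right _ _).trans hle
  exact (rateDist_le hq hV (by linarith)).trans (by linarith)

end RateDistortion

/-- Lemma 2: a parametric expression for the rate-distortion function. -/
theorem rate_distortion_parametric
    {X Y : Type*} [Fintype X] [Fintype Y] [Nonempty X] [Nonempty Y]
    (d : X → Y → ℝ) (hd : ∀ x y, 0 ≤ d x y)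
    (hd0 : (⨆ x, ⨅ y, d x y) = 0)
    (q : X → ℝ) (hq : IsDist q) (Δ : ℝ) (hΔ : 0 ≤ Δ) :
    rateDist d Δ q = sSup { v | ∃ ν : ℝ, 0 ≤ ν ∧
      v = -ν * Δ + sInf { g | ∃ pY : Y → ℝ, IsDist pY ∧
        g = -∑ x, q x * Real.log (∑ y, pY y * Real.exp (-ν * d x y)) } } := by
  obtain ⟨V₀, hV₀, h₀⟩ := exists_isCondDist_expDist_eq_zero hd hd0 q
  have hp₀ := isDist_outDist hq hV₀
  have hlag {ν : ℝ} {p : Y → ℝ} (hp : IsDist p) : ∃ V : X → Y → ℝ, IsCondDist V ∧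
      mutInfo q V + ν * expDist d q V ≤
        -∑ x, q x * Real.log (∑ y, p y * Real.exp (-ν * d x y)) :=
    exists_lagrangian_le_neg_sum_log_tiltSum hq hp
  have hnn {V : X → Y → ℝ} (hV : IsCondDist V) : 0 ≤ expDist d q V :=
    Finset.sum_nonneg fun x _ => Finset.sum_nonneg fun y _ =>
      mul_nonneg (mul_nonneg (hq.1 x) ((hV x).1 y)) (hd x y)
  have hweak : ∀ v ∈ { v | ∃ ν : ℝ, 0 ≤ ν ∧
      v = -ν * Δ + sInf { g | ∃ pY : Y → ℝ, IsDist pY ∧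
        g = -∑ x, q x * Real.log (∑ y, pY y * Real.exp (-ν * d x y)) } },
      v ≤ rateDist d Δ q := by
    rintro _ ⟨ν, hν, rfl⟩
    refine le_rateDist ⟨V₀, hV₀, h₀.trans_le hΔ⟩ fun V hV hVΔ => ?_
    have h1 := csInf_le (s := { g | ∃ pY : Y → ℝ, IsDist pY ∧
        g = -∑ x, q x * Real.log (∑ y, pY y * Real.exp (-ν * d x y)) }) ⟨0, by
      rintro _ ⟨p, hp, rfl⟩
      obtain ⟨W, hW, hle⟩ := hlag (ν := ν) hp
      exact (add_nonneg (mutInfo_nonneg hq hW) (mul_nonneg hν (hnn hW))).trans hle⟩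
      ⟨_, isDist_outDist hq hV, rfl⟩
    have h2 := neg_sum_log_tiltSum_outDist_le (d := d) (ν := ν) hq hV
    unfold tiltSum at h2
    have h3 := mul_le_mul_of_nonneg_left hVΔ hν
    linarith
  refine le_antisymm ?_ (csSup_le ⟨_, 0, le_rfl, rfl⟩ hweak)
  refine rateDist_le_of_forall_pos hq ⟨V₀, hV₀, h₀.trans_le hΔ⟩ fun ε hε => ?_
  obtain ⟨ν, hν, hmul⟩ := exists_multiplier hq hd ⟨V₀, hV₀, h₀⟩ (add_pos_of_nonneg_of_pos hΔ hε)
  refine le_csSup_of_le ⟨_, hweak⟩ ⟨ν, hν, rfl⟩ ?_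
  have h1 : rateDist d (Δ + ε) q + ν * (Δ + ε) ≤ sInf { g | ∃ pY : Y → ℝ, IsDist pY ∧
      g = -∑ x, q x * Real.log (∑ y, pY y * Real.exp (-ν * d x y)) } := by
    refine le_csInf ⟨_, _, hp₀, rfl⟩ ?_
    rintro _ ⟨p, hp, rfl⟩
    obtain ⟨W, hW, hle⟩ := hlag (ν := ν) hp
    exact (hmul W hW).trans hle
  have h2 := mul_nonneg hν hε.le
  linarith
end

section
/- For every ν ≥ 0, E ≥ 0, probability distribution p_Y on 𝒴, and probability distribution P on 𝒳, the constrained maximum G^{(ν)}(E, p_Y|P) := max_{q ∈ 𝒫(𝒳): D(q‖P) ≤ E} [ −∑_x q(x) log ∑_y p_Y(y) e^{−ν d(x,y)} ] satisfies G^{(ν)}(E, p_Y|P) = inf_{μ≥0} { μE + G^{(μ,ν)}(p_Y|P) }, where G^{(μ,ν)}(p_Y|P) = max_{q ∈ 𝒫(𝒳)} [ −μ D(q‖P) − ∑_x q(x) log ∑_y p_Y(y) e^{−ν d(x,y)} ]. -/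
open scoped BigOperators

/-- The relative entropy of an absolutely continuous distribution in terms of `Real.negMulLog`. -/
theorem relEnt_eq_sum_negMulLog {X : Type*} [Fintype X] {q P : X → ℝ} (hq : AbsCont q P) :
    relEnt q P = ∑ x, (-Real.negMulLog (q x) - q x * Real.log (P x)) := by
  refine Finset.sum_congr rfl fun x _ => ?_
  split_ifs with h
  · simp [h]
  · rw [Real.log_div h fun hP => h (hq x hP), Real.negMulLog]
    ring

theorem relEnt_self {X : Type*} [Fintype X] (P : X → ℝ) : relEnt P P = 0 := by
  refine Finset.sum_eq_zero fun x _ => ?_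
  split_ifs with h
  · rfl
  · simp [div_self h]

/-- Gibbs' inequality. -/
theorem relEnt_nonneg {X : Type*} [Fintype X] {q P : X → ℝ} (hq : IsDist q) (hP : IsDist P)
    (hac : AbsCont q P) : 0 ≤ relEnt q P := by
  have hsum : ∑ x, (q x - P x) ≤ relEnt q P := by
    refine Finset.sum_le_sum fun x _ => ?_
    split_ifs with h
    · simpa [h] using hP.1 x
    · have hqx : 0 < q x := lt_of_le_of_ne (hq.1 x) (Ne.symm h)
      have hPx : 0 < P x := lt_of_le_of_ne (hP.1 x) fun h0 => h (hac x h0.symm)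
      have hlog := mul_le_mul_of_nonneg_left
        (Real.one_sub_inv_le_log_of_pos (div_pos hqx hPx)) hqx.le
      have heq : q x * (1 - (q x / P x)⁻¹) = q x - P x := by field_simp
      linarith
  rwa [Finset.sum_sub_distrib, hq.2, hP.2, sub_self] at hsum

theorem relEnt_convexComb_le {X : Type*} [Fintype X] {q r P : X → ℝ} (hq : IsDist q)
    (hr : IsDist r) (hqP : AbsCont q P) (hrP : AbsCont r P) {a b : ℝ} (ha : 0 ≤ a) (hb : 0 ≤ b)
    (hab : a + b = 1) : relEnt (a • q + b • r) P ≤ a * relEnt q P + b * relEnt r P := by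
  have hac : AbsCont (a • q + b • r) P := fun x hx => by simp [hqP x hx, hrP x hx]
  rw [relEnt_eq_sum_negMulLog hac, relEnt_eq_sum_negMulLog hqP, relEnt_eq_sum_negMulLog hrP,
    Finset.mul_sum, Finset.mul_sum, ← Finset.sum_add_distrib]
  refine Finset.sum_le_sum fun x _ => ?_
  have h := Real.concaveOn_negMulLog.2 (hq.1 x) (hr.1 x) ha hb hab
  simp only [smul_eq_mul, Pi.add_apply, Pi.smul_apply] at h ⊢
  linarith

theorem IsDist.convexComb {X : Type*} [Fintype X] {q r : X → ℝ} (hq : IsDist q) (hr : IsDist r)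
    {a b : ℝ} (ha : 0 ≤ a) (hb : 0 ≤ b) (hab : a + b = 1) : IsDist (a • q + b • r) :=
  convex_stdSimplex ℝ X hq hr ha hb hab

theorem isCompact_setOf_isDist_absCont {X : Type*} [Fintype X] (P : X → ℝ) :
    IsCompact {q : X → ℝ | IsDist q ∧ AbsCont q P} := by
  refine (isCompact_stdSimplex ℝ X).inter_right (t := {q | AbsCont q P}) ?_
  simp only [AbsCont, Set.ofPred_forall]
  exact isClosed_iInter fun x => isClosed_iInter fun _ =>
    isClosed_eq (continuous_apply x) continuous_const

theorem neg_sum_mul_le_sum_abs {X : Type*} [Fintype X] {q : X → ℝ} (hq : IsDist q) (c : X → ℝ) :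
    -∑ x, q x * c x ≤ ∑ x, |c x| := by
  rw [← Finset.sum_neg_distrib]
  refine Finset.sum_le_sum fun x hx => ?_
  have h1 : q x ≤ 1 := hq.2 ▸ Finset.single_le_sum (fun y _ => hq.1 y) hx
  calc -(q x * c x) ≤ |q x * c x| := neg_le_abs _
    _ = q x * |c x| := by rw [abs_mul, abs_of_nonneg (hq.1 x)]
    _ ≤ |c x| := mul_le_of_le_one_left (abs_nonneg _) h1

/-- The pairs (divergence budget, guaranteed value) achievable for the linear objective
`q ↦ -∑ x, q x * c x` under a relative entropy constraint. -/
def achievableSet {X : Type*} [Fintype X] (P c : X → ℝ) : Set (ℝ × ℝ) :=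
  {p | ∃ q : X → ℝ, IsDist q ∧ AbsCont q P ∧ relEnt q P ≤ p.1 ∧ p.2 ≤ -∑ x, q x * c x}

theorem convex_achievableSet {X : Type*} [Fintype X] (P c : X → ℝ) :
    Convex ℝ (achievableSet P c) := by
  rintro p ⟨q, hq, hqP, hq1, hq2⟩ p' ⟨r, hr, hrP, hr1, hr2⟩ a b ha hb hab
  refine ⟨a • q + b • r, hq.convexComb hr ha hb hab,
    fun x hx => by simp [hqP x hx, hrP x hx], ?_, ?_⟩
  · refine (relEnt_convexComb_le hq hr hqP hrP ha hb hab).trans ?_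
    simp only [Prod.fst_add, Prod.smul_fst, smul_eq_mul]
    gcongr
  · have hlin : -∑ x, (a • q + b • r) x * c x
        = a * (-∑ x, q x * c x) + b * (-∑ x, r x * c x) := by
      simp only [Pi.add_apply, Pi.smul_apply, smul_eq_mul, add_mul, Finset.sum_add_distrib,
        mul_assoc, ← Finset.mul_sum]
      ring
    rw [hlin]
    simp only [Prod.snd_add, Prod.smul_snd, smul_eq_mul]
    gcongr

theorem isClosed_achievableSet {X : Type*} [Fintype X] (P c : X → ℝ) :
    IsClosed (achievableSet P c) := by
  have hK := isCompact_setOf_isDist_absCont P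
  have : CompactSpace {q : X → ℝ | IsDist q ∧ AbsCont q P} := isCompact_iff_compactSpace.mp hK
  let Z : Set ({q : X → ℝ | IsDist q ∧ AbsCont q P} × (ℝ × ℝ)) :=
    {z | ∑ x, (-Real.negMulLog (z.1.1 x) - z.1.1 x * Real.log (P x)) ≤ z.2.1 ∧
      z.2.2 ≤ -∑ x, z.1.1 x * c x}
  have hZ : IsClosed Z := by
    have hcoord : ∀ x, Continuous
        fun z : {q : X → ℝ | IsDist q ∧ AbsCont q P} × (ℝ × ℝ) => z.1.1 x := fun x =>
      (continuous_apply x).comp (continuous_subtype_val.comp continuous_fst)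
    refine IsClosed.and (isClosed_le ?_ ?_) (isClosed_le ?_ ?_)
    · exact continuous_finsetSum _ fun x _ =>
        (Real.continuous_negMulLog.comp (hcoord x)).neg.sub ((hcoord x).mul continuous_const)
    · fun_prop
    · fun_prop
    · exact (continuous_finsetSum _ fun x _ => (hcoord x).mul continuous_const).neg
  convert isClosedMap_snd_of_compactSpace Z hZ using 1
  ext p
  constructor
  · rintro ⟨q, hq, hqP, h1, h2⟩
    exact ⟨(⟨q, hq, hqP⟩, p), ⟨relEnt_eq_sum_negMulLog hqP ▸ h1, h2⟩, rfl⟩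
  · rintro ⟨⟨⟨q, hq, hqP⟩, p'⟩, ⟨h1, h2⟩, rfl⟩
    exact ⟨q, hq, hqP, (relEnt_eq_sum_negMulLog hqP).trans_le h1, h2⟩

/-- A Lagrange multiplier that is optimal up to an arbitrarily small error: if `v` strictly
exceeds every value attainable with divergence at most `E`, then some penalty `μ` certifies it. -/
theorem exists_multiplier_s7 {X : Type*} [Fintype X] {P : X → ℝ} (hP : IsDist P) (c : X → ℝ)
    {E v : ℝ} (hE : 0 ≤ E) (hv : (E, v) ∉ achievableSet P c) :
    ∃ μ : ℝ, 0 ≤ μ ∧ ∀ q, IsDist q → AbsCont q P →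
      μ * E + (-μ * relEnt q P - ∑ x, q x * c x) ≤ v := by
  obtain ⟨φ, s, hs, hsv⟩ := geometric_hahn_banach_closed_point
    (convex_achievableSet P c) (isClosed_achievableSet P c) hv
  obtain ⟨α, hα⟩ : ∃ α, α = φ (1, 0) := ⟨_, rfl⟩
  obtain ⟨β, hβ⟩ : ∃ β, β = φ (0, 1) := ⟨_, rfl⟩
  have hφ : ∀ a b : ℝ, φ (a, b) = a * α + b * β := fun a b => by
    have : ((a, b) : ℝ × ℝ) = a • (1, 0) + b • (0, 1) := by simp
    rw [this, map_add, map_smul, map_smul, hα, hβ, smul_eq_mul, smul_eq_mul]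
  rw [hφ] at hsv
  have hbound : ∀ q, IsDist q → AbsCont q P → ∀ t u : ℝ, 0 ≤ t → 0 ≤ u →
      (relEnt q P + t) * α + (-∑ x, q x * c x - u) * β < s := fun q hq hqP t u ht hu => by
    rw [← hφ]
    exact hs _ ⟨q, hq, hqP, by simpa using ht, by simpa using hu⟩
  have hPP : AbsCont P P := fun _ h => h
  have hα0 : α ≤ 0 := by
    by_contra! h
    have hlt := hbound P hP hPP (|s - -(∑ x, P x * c x) * β| / α) 0 (by positivity) le_rfl
    rw [relEnt_self, zero_add, sub_zero, div_mul_cancel₀ _ h.ne'] at hlt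
    linarith [le_abs_self (s - -(∑ x, P x * c x) * β)]
  have hβ0 : 0 < β := by
    by_contra! h
    rcases h.lt_or_eq with h | h
    · have hlt := hbound P hP hPP 0 (|s - -(∑ x, P x * c x) * β| / -β) le_rfl
        (div_nonneg (abs_nonneg _) (by linarith))
      have hcancel : |s - -(∑ x, P x * c x) * β| / -β * β = -|s - -(∑ x, P x * c x) * β| := by
        rw [div_neg, neg_mul, div_mul_cancel₀ _ h.ne]
      rw [relEnt_self, sub_mul, hcancel] at hlt
      linarith [le_abs_self (s - -(∑ x, P x * c x) * β)]
    · have hlt := hbound P hP hPP E 0 hE le_rfl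
      rw [relEnt_self, h] at hlt
      rw [h] at hsv
      linarith
  refine ⟨-α / β, div_nonneg (by linarith) hβ0.le, fun q hq hqP => ?_⟩
  have hlt := hbound q hq hqP 0 0 le_rfl le_rfl
  rw [← mul_le_mul_iff_left₀ hβ0]
  have heq : (-α / β * E + (-(-α / β) * relEnt q P - ∑ x, q x * c x)) * β
      = -α * E + α * relEnt q P - (∑ x, q x * c x) * β := by
    field_simp
    ring
  rw [heq]
  linarith

/-- Lagrangian duality for maximizing a linear functional under a relative entropy constraint. -/
theorem sSup_relEnt_constraint_eq_sInf {X : Type*} [Fintype X] {P : X → ℝ} (hP : IsDist P)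
    (c : X → ℝ) {E : ℝ} (hE : 0 ≤ E) :
    sSup { v | ∃ q : X → ℝ, IsDist q ∧ AbsCont q P ∧ relEnt q P ≤ E ∧
        v = -∑ x, q x * c x }
      = sInf { w | ∃ μ : ℝ, 0 ≤ μ ∧ w = μ * E +
          sSup { v | ∃ q : X → ℝ, IsDist q ∧ (0 < μ → AbsCont q P) ∧
            v = -μ * relEnt q P - ∑ x, q x * c x } } := by
  have hPP : AbsCont P P := fun _ h => h
  have hbdd : BddAbove { v | ∃ q : X → ℝ, IsDist q ∧ AbsCont q P ∧ relEnt q P ≤ E ∧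
      v = -∑ x, q x * c x } := by
    refine ⟨∑ x, |c x|, ?_⟩
    rintro _ ⟨q, hq, -, -, rfl⟩
    exact neg_sum_mul_le_sum_abs hq c
  have hbdd' : ∀ μ : ℝ, 0 ≤ μ → BddAbove { v | ∃ q : X → ℝ, IsDist q ∧
      (0 < μ → AbsCont q P) ∧ v = -μ * relEnt q P - ∑ x, q x * c x } := by
    refine fun μ hμ => ⟨∑ x, |c x|, ?_⟩
    rintro _ ⟨q, hq, hqP, rfl⟩
    have hle := neg_sum_mul_le_sum_abs hq c
    rcases hμ.eq_or_lt with rfl | hμ'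
    · simpa using hle
    · linarith [mul_nonneg hμ (relEnt_nonneg hq hP (hqP hμ'))]
  have hweak : ∀ w ∈ { w | ∃ μ : ℝ, 0 ≤ μ ∧ w = μ * E +
      sSup { v | ∃ q : X → ℝ, IsDist q ∧ (0 < μ → AbsCont q P) ∧
        v = -μ * relEnt q P - ∑ x, q x * c x } },
      sSup { v | ∃ q : X → ℝ, IsDist q ∧ AbsCont q P ∧ relEnt q P ≤ E ∧
        v = -∑ x, q x * c x } ≤ w := by
    rintro _ ⟨μ, hμ, rfl⟩
    refine csSup_le ⟨_, P, hP, hPP, (relEnt_self P).trans_le hE, rfl⟩ ?_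
    rintro _ ⟨q, hq, hqP, hqE, rfl⟩
    have hle := le_csSup (hbdd' μ hμ) ⟨q, hq, fun _ => hqP, rfl⟩
    linarith [mul_le_mul_of_nonneg_left hqE hμ]
  refine le_antisymm (le_csInf ⟨_, 0, le_rfl, rfl⟩ hweak) (le_of_forall_pos_le_add fun ε hε => ?_)
  set V := sSup { v | ∃ q : X → ℝ, IsDist q ∧ AbsCont q P ∧ relEnt q P ≤ E ∧
    v = -∑ x, q x * c x }
  obtain ⟨μ, hμ, hμq⟩ := exists_multiplier_s7 hP c (v := V + ε / 2) hE (by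
    rintro ⟨q, hq, hqP, hqE, hqV⟩
    have hle : -∑ x, q x * c x ≤ V := le_csSup hbdd ⟨q, hq, hqP, hqE, rfl⟩
    dsimp only at hqV
    linarith)
  -- Enlarging `μ` slightly makes it positive, so that absolute continuity is enforced.
  obtain ⟨δ, hδ, hδE⟩ : ∃ δ : ℝ, 0 < δ ∧ δ * E ≤ ε / 2 := by
    refine ⟨ε / 2 / (E + 1), by positivity, ?_⟩
    rw [div_mul_eq_mul_div, div_le_iff₀ (by positivity)]
    nlinarith
  refine (csInf_le ⟨V, hweak⟩ ⟨μ + δ, by positivity, rfl⟩).trans ?_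
  rw [← le_sub_iff_add_le']
  refine csSup_le ⟨_, P, hP, fun _ => hPP, rfl⟩ ?_
  rintro _ ⟨q, hq, hqP, rfl⟩
  have hqP' := hqP (by positivity)
  have hle := hμq q hq hqP'
  linarith [mul_nonneg hδ.le (relEnt_nonneg hq hP hqP')]

/-- Lemma 6: parametric expression for the constrained maximum `G^{(ν)}(E,p_Y|P)`. -/
theorem G_nu_parametric
    {X Y : Type*} [Fintype X] [Fintype Y] [Nonempty X] [Nonempty Y]
    (P : X → ℝ) (hP : IsDist P)
    (d : X → Y → ℝ) (hd : ∀ x y, 0 ≤ d x y)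
    (ν : ℝ) (hν : 0 ≤ ν) (E : ℝ) (hE : 0 ≤ E)
    (pY : Y → ℝ) (hpY : IsDist pY) :
    sSup { v | ∃ q : X → ℝ, IsDist q ∧ AbsCont q P ∧ relEnt q P ≤ E ∧
        v = -∑ x, q x * Real.log (∑ y, pY y * Real.exp (-ν * d x y)) }
      = sInf { w | ∃ μ : ℝ, 0 ≤ μ ∧ w = μ * E +
          sSup { v | ∃ q : X → ℝ, IsDist q ∧ (0 < μ → AbsCont q P) ∧
            v = -μ * relEnt q P
                - ∑ x, q x * Real.log (∑ y, pY y * Real.exp (-ν * d x y)) } } := by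
  exact sSup_relEnt_constraint_eq_sInf hP _ hE
end
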